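/- arXiv:gr-qc/0309016 — 2 statements merged into one kernel-verified Lean document; each statement's English description precedes it below -/
import Mathlib

section
/- Let f, g, h : ℝ → ℝ be polynomial functions such that (1−τ)⁴ divides f(τ) and (1+τ)⁴ divides g(τ), let c ∈ ℝ, and define φ : (−1,1) → ℝ by φ(τ) = c·(f(τ)·log(1−τ) + g(τ)·log(1+τ)) + h(τ). Then φ extends to a three-times continuously differentiable function on the closed interval [−1,1]. If moreover c ≠ 0 and the polynomial f(τ)/(1−τ)⁴ does not vanish at τ = 1, then φ admits no four-times differentiable extension to any neighbourhood of τ = 1. -/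
open Polynomial Real Set
open Filter Topology

theorem contDiff_pow_succ_mul_log (n : ℕ) :
    ContDiff ℝ n (fun x : ℝ => x ^ (n + 1) * Real.log x) := by
  induction n with
  | zero =>
    simpa [contDiff_zero] using Real.continuous_mul_log
  | succ n ih =>
    have hderiv : ∀ x : ℝ, HasDerivAt (fun x : ℝ => x ^ (n + 1 + 1) * Real.log x)
        ((n + 2) * (x ^ (n + 1) * Real.log x) + x ^ (n + 1)) x := by
      intro x
      rcases eq_or_ne x 0 with rfl | hx
      · rw [hasDerivAt_iff_tendsto_slope]
        have hc : Tendsto (fun x : ℝ => x ^ n * (x * Real.log x)) (𝓝[≠] 0) (𝓝 0) :=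
          (((continuous_pow n).mul Real.continuous_mul_log).tendsto' 0 0 (by simp)).mono_left
            nhdsWithin_le_nhds
        simp only [ne_eq, Nat.add_eq_zero_iff, one_ne_zero, and_false, not_false_eq_true,
          zero_pow, zero_mul, mul_zero, add_zero]
        refine hc.congr' ?_
        filter_upwards [self_mem_nhdsWithin] with y hy
        have hy0 : y ≠ 0 := hy
        simp [slope_def_field]
        field_simp
        ring
      · refine ((hasDerivAt_pow (n + 1 + 1) x).mul (Real.hasDerivAt_log hx)).congr_deriv ?_
        push_cast
        field_simp
        ring
    have hd : deriv (fun x : ℝ => x ^ (n + 1 + 1) * Real.log x) =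
        fun x => (n + 2) * (x ^ (n + 1) * Real.log x) + x ^ (n + 1) :=
      funext fun x => (hderiv x).deriv
    rw [Nat.cast_succ, contDiff_succ_iff_deriv]
    refine ⟨fun x => (hderiv x).differentiableAt, by simp, ?_⟩
    rw [hd]
    exact (contDiff_const.mul ih).add (contDiff_id.pow _)

theorem deriv_eventuallyEq_pow_mul_log_add {F r : ℝ → ℝ} {p : ℝ[X]} {m : ℕ}
    (hr : AnalyticAt ℝ r 1)
    (hF : F =ᶠ[𝓝[<] 1] fun x => (1 - x) ^ (m + 1) * Real.log (1 - x) * p.eval x + r x) :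
    deriv F =ᶠ[𝓝[<] 1] fun x => (1 - x) ^ m * Real.log (1 - x) *
      ((1 - X) * derivative p - C (m + 1 : ℝ) * p).eval x +
        (deriv r x - (1 - x) ^ m * p.eval x) := by
  filter_upwards [eventually_eventually_nhdsWithin.2 hF, self_mem_nhdsWithin,
    nhdsWithin_le_nhds hr.eventually_analyticAt] with x hx hlt hrx
  have hx1 : x < 1 := hlt
  have hne : 1 - x ≠ 0 := by linarith
  rw [isOpen_Iio.nhdsWithin_eq hx1] at hx
  rw [Filter.EventuallyEq.deriv_eq hx]
  have hsub : HasDerivAt (fun x : ℝ => 1 - x) (-1) x := by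
    simpa using (hasDerivAt_id x).const_sub 1
  have h := (((hsub.pow (m + 1)).mul (hsub.log hne)).mul (p.hasDerivAt x)).add
    hrx.differentiableAt.hasDerivAt
  refine h.deriv.trans ?_
  simp
  field_simp
  ring

theorem not_differentiableAt_mul_log_add {F r : ℝ → ℝ} {p : ℝ[X]} (hp : p.eval 1 ≠ 0)
    (hr : DifferentiableAt ℝ r 1)
    (hF : F =ᶠ[𝓝[<] 1] fun x => (1 - x) * Real.log (1 - x) * p.eval x + r x) :
    ¬ DifferentiableAt ℝ F 1 := by
  intro hd
  have hG : DifferentiableAt ℝ (fun x => F x - r x) 1 := hd.sub hr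
  have hGF : (fun x => F x - r x) =ᶠ[𝓝[<] 1]
      fun x => (1 - x) * Real.log (1 - x) * p.eval x := by
    filter_upwards [hF] with x hx
    rw [hx]; ring
  have hcont : Continuous fun x : ℝ => (1 - x) * Real.log (1 - x) * p.eval x :=
    (Real.continuous_mul_log.comp (continuous_const.sub continuous_id)).mul p.continuous
  have hG1 : F 1 - r 1 = 0 := by
    have h1 := hG.continuousAt.tendsto.mono_left (nhdsWithin_le_nhds (s := Iio 1))
    have h2 := ((hcont.tendsto 1).mono_left (nhdsWithin_le_nhds (s := Iio 1))).congr' hGF.symm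
    simpa using tendsto_nhds_unique h1 h2
  have hslope : Tendsto (slope (fun x => F x - r x) 1) (𝓝[<] 1)
      (𝓝 (deriv (fun x => F x - r x) 1)) :=
    hG.hasDerivAt.tendsto_slope.mono_left (nhdsWithin_mono _ fun x hx => ne_of_lt hx)
  have hlog : Tendsto (fun x : ℝ => Real.log (1 - x)) (𝓝[<] 1)
      (𝓝 (-deriv (fun x => F x - r x) 1 / p.eval 1)) := by
    have hpt : Tendsto (fun x => p.eval x) (𝓝[<] 1) (𝓝 (p.eval 1)) :=
      (p.continuous.tendsto 1).mono_left nhdsWithin_le_nhds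
    refine (hslope.neg.div hpt hp).congr' ?_
    filter_upwards [hGF, self_mem_nhdsWithin, hpt.eventually_ne hp] with x hx hlt hpx
    have hne : x - 1 ≠ 0 := sub_ne_zero.2 (ne_of_lt hlt)
    simp only [Pi.div_apply, slope_def_field, hG1, hx]
    field_simp
    ring
  have hbot : Tendsto (fun x : ℝ => Real.log (1 - x)) (𝓝[<] 1) atBot := by
    refine Real.tendsto_log_nhdsGT_zero.comp (tendsto_nhdsWithin_iff.2 ⟨?_, ?_⟩)
    · exact ((continuous_const.sub continuous_id).tendsto' (1 : ℝ) 0 (by simp)).mono_left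
        nhdsWithin_le_nhds
    · filter_upwards [self_mem_nhdsWithin] with x hx
      exact sub_pos.2 (mem_Iio.1 hx)
  exact not_tendsto_nhds_of_tendsto_atBot hbot _ hlog

theorem not_differentiableAt_iterate_deriv_pow_mul_log_add (n : ℕ) {F r : ℝ → ℝ} {p : ℝ[X]}
    (hp : p.eval 1 ≠ 0) (hr : AnalyticAt ℝ r 1)
    (hF : F =ᶠ[𝓝[<] 1] fun x => (1 - x) ^ (n + 1) * Real.log (1 - x) * p.eval x + r x) :
    ¬ DifferentiableAt ℝ (deriv^[n] F) 1 := by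
  induction n generalizing F r p with
  | zero => exact not_differentiableAt_mul_log_add hp hr.differentiableAt (by simpa using hF)
  | succ n ih =>
    refine ih ?_ ?_ (deriv_eventuallyEq_pow_mul_log_add hr hF)
    · have : (n : ℝ) + 1 + 1 ≠ 0 := by positivity
      simpa using ⟨this, hp⟩
    · have hpol : AnalyticAt ℝ (fun x => p.eval x) 1 := AnalyticOnNhd.eval_polynomial p 1 trivial
      exact hr.deriv.sub (((analyticAt_const.sub analyticAt_id).pow _).mul hpol)

/-- If `f = (1−X)⁴·k` and `g = (1+X)⁴·g'` are polynomials and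
`φ(τ) = c·(f(τ)·log(1−τ) + g(τ)·log(1+τ)) + h(τ)` on `(−1,1)`, then `φ` extends
to a `C³` function on `[−1,1]`; and if `c ≠ 0` and `k(1) ≠ 0`, then `φ` admits no
four-times differentiable extension to any neighbourhood of `τ = 1`. -/
theorem order6_obstruction_regularity
    (f g h k g' : Polynomial ℝ)
    (hfdiv : f = (1 - Polynomial.X) ^ 4 * k)
    (hgdiv : g = (1 + Polynomial.X) ^ 4 * g')
    (c : ℝ) (φ : ℝ → ℝ)
    (hφ : ∀ τ ∈ Set.Ioo (-1 : ℝ) 1,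
      φ τ = c * (f.eval τ * Real.log (1 - τ) + g.eval τ * Real.log (1 + τ)) + h.eval τ) :
    (∃ Φ : ℝ → ℝ, ContDiffOn ℝ 3 Φ (Set.Icc (-1 : ℝ) 1) ∧
        ∀ τ ∈ Set.Ioo (-1 : ℝ) 1, Φ τ = φ τ) ∧
      (c ≠ 0 → k.eval 1 ≠ 0 →
        ¬ ∃ (Φ : ℝ → ℝ) (U : Set ℝ), U ∈ nhds (1 : ℝ) ∧
            (∀ τ ∈ U ∩ Set.Ioo (-1 : ℝ) 1, Φ τ = φ τ) ∧
            DifferentiableOn ℝ Φ U ∧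
            DifferentiableOn ℝ (deriv Φ) U ∧
            DifferentiableOn ℝ (deriv (deriv Φ)) U ∧
            DifferentiableOn ℝ (deriv (deriv (deriv Φ))) U) := by
  have hφ' : ∀ τ ∈ Set.Ioo (-1 : ℝ) 1, φ τ =
      c * (((1 - τ) ^ 4 * Real.log (1 - τ)) * k.eval τ +
        ((1 + τ) ^ 4 * Real.log (1 + τ)) * g'.eval τ) + h.eval τ := by
    intro τ hτ
    rw [hφ τ hτ, hfdiv, hgdiv]
    simp only [eval_mul, eval_pow, eval_sub, eval_add, eval_one, eval_X]
    ring
  refine ⟨⟨fun τ => c * (((1 - τ) ^ 4 * Real.log (1 - τ)) * k.eval τ +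
      ((1 + τ) ^ 4 * Real.log (1 + τ)) * g'.eval τ) + h.eval τ, ?_, fun τ hτ => (hφ' τ hτ).symm⟩,
    ?_⟩
  · have hlog : ContDiff ℝ 3 fun x : ℝ => x ^ 4 * Real.log x := contDiff_pow_succ_mul_log 3
    have hpol (p : ℝ[X]) : ContDiff ℝ 3 fun x => p.eval x := by
      simpa using p.contDiff_aeval (𝕜 := ℝ) 3
    have hsub : ContDiff ℝ 3 fun x : ℝ => (1 - x) ^ 4 * Real.log (1 - x) :=
      hlog.comp (contDiff_const.sub contDiff_id)
    have hadd : ContDiff ℝ 3 fun x : ℝ => (1 + x) ^ 4 * Real.log (1 + x) :=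
      hlog.comp (contDiff_const.add contDiff_id)
    exact ((contDiff_const.mul ((hsub.mul (hpol k)).add (hadd.mul (hpol g')))).add
      (hpol h)).contDiffOn
  · rintro hc hk ⟨Φ, U, hU, hΦ, -, -, -, hd⟩
    refine not_differentiableAt_iterate_deriv_pow_mul_log_add 3 (F := Φ) (p := C c * k)
      (r := fun x => c * ((1 + x) ^ 4 * Real.log (1 + x) * g'.eval x) + h.eval x)
      (by simpa using ⟨hc, hk⟩) ?_ ?_ (hd.differentiableAt hU)
    · have hpol (p : ℝ[X]) : AnalyticAt ℝ (fun x => p.eval x) 1 :=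
        AnalyticOnNhd.eval_polynomial p 1 trivial
      have hadd : AnalyticAt ℝ (fun x : ℝ => 1 + x) 1 := analyticAt_const.add analyticAt_id
      exact (analyticAt_const.mul (((hadd.pow 4).mul (hadd.log (by norm_num))).mul
        (hpol g'))).add (hpol h)
    · filter_upwards [nhdsWithin_le_nhds hU, Ioo_mem_nhdsLT (show (-1 : ℝ) < 1 by norm_num)]
        with x hxU hx
      rw [hΦ x ⟨hxU, hx⟩, hφ' x hx]
      simp
      ring
end

section
/- Let E be a finite-dimensional real normed vector space and let A⁰, A¹, A^C, B : ℝ³ → (E →L E) be smooth maps into the continuous linear endomorphisms of E, with coordinates written (τ, ρ, ϑ). Suppose A¹(τ, 0, ϑ) = 0 for all τ, ϑ, and suppose φ : ℝ³ → E is smooth and satisfies (√2·id_E + A⁰)(∂_τ φ) + A¹(∂_ρ φ) + A^C(∂_ϑ φ) = B(φ) everywhere. For p ∈ ℕ write φ^{(p)}(τ,ϑ) = (∂_ρ)^p φ(τ,0,ϑ) and similarly A^{0(j)}, A^{1(j)}, A^{C(j)}, B^{(j)} for the j-th ρ-derivatives of the coefficients at ρ = 0. Then for every p ∈ ℕ: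 (√2·id_E + A^{0(0)})(∂_τ φ^{(p)}) + A^{C(0)}(∂_ϑ φ^{(p)}) = B^{(0)}(φ^{(p)}) + Σ_{j=1}^{p} binom(p,j) · [ B^{(j)}(φ^{(p−j)}) − A^{0(j)}(∂_τ φ^{(p−j)}) − A^{1(j)}(φ^{(p−j+1)}) − A^{C(j)}(∂_ϑ φ^{(p−j)}) ]. In particular, the equation satisfied by φ^{(p)} contains no derivatives transversal to {ρ = 0}, and its source terms involve only the jet φ^{(0)},…,φ^{(p)}. -/
open scoped BigOperators

/-- Leibniz rule for the evaluation of a curve of continuous linear maps along a curve. -/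
lemma iteratedDeriv_clm_apply_eq_sum {E F : Type*} [NormedAddCommGroup E] [NormedSpace ℝ E]
    [NormedAddCommGroup F] [NormedSpace ℝ F] {f : ℝ → E →L[ℝ] F} {g : ℝ → E}
    (hf : ContDiff ℝ (⊤ : ℕ∞) f) (hg : ContDiff ℝ (⊤ : ℕ∞) g) (n : ℕ) (x : ℝ) :
    iteratedDeriv n (fun r => f r (g r)) x =
      ∑ j ∈ Finset.range (n + 1),
        n.choose j • (iteratedDeriv j f x) (iteratedDeriv (n - j) g x) := by
  induction n generalizing x with
  | zero => simp
  | succ n ih =>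
    have hdf (j : ℕ) : HasDerivAt (iteratedDeriv j f) (iteratedDeriv (j + 1) f x) x := by
      rw [iteratedDeriv_succ]
      exact (hf.differentiable_iteratedDeriv j
        (by exact_mod_cast ENat.natCast_lt_top j) x).hasDerivAt
    have hdg (j : ℕ) : HasDerivAt (iteratedDeriv j g) (iteratedDeriv (j + 1) g x) x := by
      rw [iteratedDeriv_succ]
      exact (hg.differentiable_iteratedDeriv j
        (by exact_mod_cast ENat.natCast_lt_top j) x).hasDerivAt
    rw [iteratedDeriv_succ, funext ih,
      Finset.sum_choose_succ_nsmul (fun i j => (iteratedDeriv i f x) (iteratedDeriv j g x)) n,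
      ← Finset.sum_add_distrib]
    refine (HasDerivAt.fun_sum fun j _ => ((hdf j).clm_apply (hdg (n - j))).const_smul
      (n.choose j)).deriv.trans (Finset.sum_congr rfl fun j hj => ?_)
    rw [Nat.sub_add_comm (Finset.mem_range_succ_iff.mp hj), smul_add, add_comm]

/-- Leibniz rule with the term carrying no derivative of the operator split off. -/
lemma iteratedDeriv_clm_apply_eq_add_sum {E F : Type*} [NormedAddCommGroup E] [NormedSpace ℝ E]
    [NormedAddCommGroup F] [NormedSpace ℝ F] {f : ℝ → E →L[ℝ] F} {g : ℝ → E}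
    (hf : ContDiff ℝ (⊤ : ℕ∞) f) (hg : ContDiff ℝ (⊤ : ℕ∞) g) (n : ℕ) (x : ℝ) :
    iteratedDeriv n (fun r => f r (g r)) x =
      f x (iteratedDeriv n g x) + ∑ j ∈ Finset.Icc 1 n,
        (n.choose j : ℝ) • (iteratedDeriv j f x) (iteratedDeriv (n - j) g x) := by
  rw [iteratedDeriv_clm_apply_eq_sum hf hg, Finset.range_eq_Ico,
    Finset.sum_eq_sum_Ico_succ_bot (Nat.succ_pos n)]
  simp only [Nat.cast_smul_eq_nsmul]
  simp [Finset.Ico_add_one_right_eq_Icc]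

section Partial

variable {F : Type*} [NormedAddCommGroup F] [NormedSpace ℝ F] {ψ : ℝ × ℝ → F}

lemma hasDerivAt_fst_slice (hψ : Differentiable ℝ ψ) (t r : ℝ) :
    HasDerivAt (fun s => ψ (s, r)) (fderiv ℝ ψ (t, r) (1, 0)) t :=
  (hψ (t, r)).hasFDerivAt.comp_hasDerivAt t ((hasDerivAt_id t).prodMk (hasDerivAt_const t r))

lemma hasDerivAt_snd_slice (hψ : Differentiable ℝ ψ) (t r : ℝ) :
    HasDerivAt (fun s => ψ (t, s)) (fderiv ℝ ψ (t, r) (0, 1)) r :=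
  (hψ (t, r)).hasFDerivAt.comp_hasDerivAt r ((hasDerivAt_const r t).prodMk (hasDerivAt_id r))

lemma contDiff_fderiv_apply_const (hψ : ContDiff ℝ (⊤ : ℕ∞) ψ) (v : ℝ × ℝ) :
    ContDiff ℝ (⊤ : ℕ∞) (fun z => fderiv ℝ ψ z v) :=
  (hψ.fderiv_right (by simp)).clm_apply contDiff_const

lemma contDiff_deriv_fst_slice (hψ : ContDiff ℝ (⊤ : ℕ∞) ψ) (t : ℝ) :
    ContDiff ℝ (⊤ : ℕ∞) (fun r => deriv (fun s => ψ (s, r)) t) := by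
  simp_rw [fun r => (hasDerivAt_fst_slice (hψ.differentiable (by simp)) t r).deriv]
  exact (contDiff_fderiv_apply_const hψ _).comp (contDiff_const.prodMk contDiff_id)

lemma fderiv_fderiv_apply_comm (hψ : ContDiff ℝ (⊤ : ℕ∞) ψ) (z v w : ℝ × ℝ) :
    fderiv ℝ (fun y => fderiv ℝ ψ y v) z w = fderiv ℝ (fun y => fderiv ℝ ψ y w) z v := by
  have hd : DifferentiableAt ℝ (fderiv ℝ ψ) z :=
    (hψ.fderiv_right (m := (⊤ : ℕ∞)) (by simp)).differentiable (by simp) z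
  have hs : IsSymmSndFDerivAt ℝ ψ z :=
    hψ.contDiffAt.isSymmSndFDerivAt <| by
      rw [minSmoothness_of_isRCLikeNormedField]
      exact WithTop.coe_le_coe.mpr (le_top (a := (2 : ℕ∞)))
  rw [fderiv_clm_apply hd (by fun_prop), fderiv_clm_apply hd (by fun_prop)]
  simpa using hs w v

/-- A partial derivative in the first variable commutes with iterated partial derivatives in the
second one. -/
lemma deriv_iteratedDeriv_slice_comm (hψ : ContDiff ℝ (⊤ : ℕ∞) ψ) (n : ℕ) (t r : ℝ) :
    deriv (fun s => iteratedDeriv n (fun u => ψ (s, u)) r) t =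
      iteratedDeriv n (fun u => deriv (fun s => ψ (s, u)) t) r := by
  induction n generalizing ψ with
  | zero => simp
  | succ n ih =>
    have h₁ := contDiff_fderiv_apply_const hψ (1, 0)
    have h₂ := contDiff_fderiv_apply_const hψ (0, 1)
    have hψd : Differentiable ℝ ψ := hψ.differentiable (by simp)
    simp_rw [iteratedDeriv_succ', fun s => funext fun u => (hasDerivAt_snd_slice hψd s u).deriv]
    rw [ih h₂]
    congr 1
    funext u
    simp_rw [fun u => (hasDerivAt_fst_slice hψd t u).deriv]
    rw [(hasDerivAt_fst_slice (h₂.differentiable (by simp)) t u).deriv,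
      (hasDerivAt_snd_slice (h₁.differentiable (by simp)) t u).deriv,
      fderiv_fderiv_apply_comm hψ]

end Partial

/-- derivation of the p-th order Bianchi transport equations.
If `A¹(τ,0,ϑ) = 0` (the hypersurface `{ρ = 0}` is a total characteristic) and
`(√2·id + A⁰)(∂_τ φ) + A¹(∂_ρ φ) + A^C(∂_ϑ φ) = B(φ)`, then for every `p` the
p-th radial derivative `φ⁽ᵖ⁾(τ,ϑ) = (∂_ρ)ᵖ φ(τ,0,ϑ)` satisfies an intrinsic
linear system on `{ρ = 0}` with sources built from the lower-order jet. -/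
theorem bianchi_transport_equations
    {E : Type*} [NormedAddCommGroup E] [NormedSpace ℝ E] [FiniteDimensional ℝ E]
    (A0 A1 AC B : ℝ × ℝ × ℝ → E →L[ℝ] E)
    (hA0 : ContDiff ℝ (⊤ : ℕ∞) A0) (hA1 : ContDiff ℝ (⊤ : ℕ∞) A1)
    (hAC : ContDiff ℝ (⊤ : ℕ∞) AC) (hB : ContDiff ℝ (⊤ : ℕ∞) B)
    (hchar : ∀ τ ϑ : ℝ, A1 (τ, 0, ϑ) = 0)
    (φ : ℝ × ℝ × ℝ → E) (hφ : ContDiff ℝ (⊤ : ℕ∞) φ)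
    (heq : ∀ τ ρ ϑ : ℝ,
      (Real.sqrt 2 • ContinuousLinearMap.id ℝ E + A0 (τ, ρ, ϑ))
          (deriv (fun t => φ (t, ρ, ϑ)) τ) +
        A1 (τ, ρ, ϑ) (deriv (fun r => φ (τ, r, ϑ)) ρ) +
        AC (τ, ρ, ϑ) (deriv (fun θ => φ (τ, ρ, θ)) ϑ) =
        B (τ, ρ, ϑ) (φ (τ, ρ, ϑ))) :
    ∀ (p : ℕ) (τ ϑ : ℝ),
      (Real.sqrt 2 • ContinuousLinearMap.id ℝ E + A0 (τ, 0, ϑ))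
          (deriv (fun t => iteratedDeriv p (fun r => φ (t, r, ϑ)) 0) τ) +
        AC (τ, 0, ϑ) (deriv (fun θ => iteratedDeriv p (fun r => φ (τ, r, θ)) 0) ϑ) =
        B (τ, 0, ϑ) (iteratedDeriv p (fun r => φ (τ, r, ϑ)) 0) +
          ∑ j ∈ Finset.Icc 1 p, (p.choose j : ℝ) •
            ((iteratedDeriv j (fun r => B (τ, r, ϑ)) 0)
                (iteratedDeriv (p - j) (fun r => φ (τ, r, ϑ)) 0) -
              (iteratedDeriv j (fun r => A0 (τ, r, ϑ)) 0)
                (deriv (fun t => iteratedDeriv (p - j) (fun r => φ (t, r, ϑ)) 0) τ) -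
              (iteratedDeriv j (fun r => A1 (τ, r, ϑ)) 0)
                (iteratedDeriv (p - j + 1) (fun r => φ (τ, r, ϑ)) 0) -
              (iteratedDeriv j (fun r => AC (τ, r, ϑ)) 0)
                (deriv (fun θ => iteratedDeriv (p - j) (fun r => φ (τ, r, θ)) 0) ϑ)) := by
  intro p τ ϑ
  have hline {G : Type _} [NormedAddCommGroup G] [NormedSpace ℝ G] {f : ℝ × ℝ × ℝ → G}
      (hf : ContDiff ℝ (⊤ : ℕ∞) f) : ContDiff ℝ (⊤ : ℕ∞) (fun r => f (τ, r, ϑ)) :=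
    hf.comp (contDiff_const.prodMk (contDiff_id.prodMk contDiff_const))
  have hφτ : ContDiff ℝ (⊤ : ℕ∞) (fun z : ℝ × ℝ => φ (z.1, z.2, ϑ)) :=
    hφ.comp (contDiff_fst.prodMk (contDiff_snd.prodMk contDiff_const))
  have hφϑ : ContDiff ℝ (⊤ : ℕ∞) (fun z : ℝ × ℝ => φ (τ, z.2, z.1)) :=
    hφ.comp (contDiff_const.prodMk (contDiff_snd.prodMk contDiff_fst))
  have hcommτ (n : ℕ) := deriv_iteratedDeriv_slice_comm hφτ n τ 0
  have hcommϑ (n : ℕ) := deriv_iteratedDeriv_slice_comm hφϑ n ϑ 0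
  have hτ := contDiff_deriv_fst_slice hφτ τ
  have hϑ := contDiff_deriv_fst_slice hφϑ ϑ
  have hρ : ContDiff ℝ (⊤ : ℕ∞) (deriv fun r => φ (τ, r, ϑ)) :=
    (contDiff_infty_iff_deriv.mp (hline hφ)).2
  have hC : ContDiff ℝ (⊤ : ℕ∞)
      (fun r => Real.sqrt 2 • ContinuousLinearMap.id ℝ E + A0 (τ, r, ϑ)) :=
    contDiff_const.add (hline hA0)
  have key := congrArg (fun f => iteratedDeriv p f 0) (funext fun ρ => heq τ ρ ϑ)
  have hp : ((p : ℕ∞) : WithTop ℕ∞) ≤ ((⊤ : ℕ∞) : WithTop ℕ∞) := by exact_mod_cast le_top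
  have c₀ := ((hC.clm_apply hτ).of_le hp).contDiffAt (x := 0)
  have c₁ := (((hline hA1).clm_apply hρ).of_le hp).contDiffAt (x := 0)
  have c₂ := (((hline hAC).clm_apply hϑ).of_le hp).contDiffAt (x := 0)
  dsimp only at key hcommτ hcommϑ
  rw [iteratedDeriv_fun_add (c₀.add c₁) c₂, iteratedDeriv_fun_add c₀ c₁,
    iteratedDeriv_clm_apply_eq_add_sum hC hτ, iteratedDeriv_clm_apply_eq_add_sum (hline hA1) hρ,
    iteratedDeriv_clm_apply_eq_add_sum (hline hAC) hϑ,
    iteratedDeriv_clm_apply_eq_add_sum (hline hB) (hline hφ), hchar] at key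
  simp_rw [hcommτ, hcommϑ, smul_sub, Finset.sum_sub_distrib, iteratedDeriv_succ']
  have hA : ∑ j ∈ Finset.Icc 1 p, (p.choose j : ℝ) •
        (iteratedDeriv j (fun r => Real.sqrt 2 • ContinuousLinearMap.id ℝ E + A0 (τ, r, ϑ)) 0)
          (iteratedDeriv (p - j) (fun u => deriv (fun s => φ (s, u, ϑ)) τ) 0) =
      ∑ j ∈ Finset.Icc 1 p, (p.choose j : ℝ) • (iteratedDeriv j (fun r => A0 (τ, r, ϑ)) 0)
          (iteratedDeriv (p - j) (fun u => deriv (fun s => φ (s, u, ϑ)) τ) 0) :=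
    Finset.sum_congr rfl fun j hj => by
      rw [iteratedDeriv_const_add (Finset.mem_Icc.mp hj).1]
  rw [hA, zero_apply, zero_add] at key
  rw [← sub_eq_zero] at key ⊢
  rw [← key]
  abel
end
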